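/- arXiv:2510.07170 — 6 statements merged into one kernel-verified Lean document; each statement's English description precedes it below -/
import Mathlib

section
/- Let A be an abelian category and let U be a full subcategory of A, closed under isomorphisms, containing the zero objects, closed under extensions, and left filtering. Let W_U be the class of morphisms of A that are epimorphisms with kernel in U, and let Q : A → A[W_U⁻¹] be the localization functor. Then: (a) Q(0) is a zero object of A[W_U⁻¹]; (b) a morphism f : x → y of A has the property that Q f factors through Q(0) if and only if f factors in A through an object of U; (c) an object x of A satisfies Q x ≅ Q(0) if and only if x is a retract of an object of U. -/
open CategoryTheory CategoryTheory.Limits Opposite ZeroObject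

universe w v u u₂

variable {A : Type u} [Category.{v} A] [Abelian A]

/-- The class `W_U` of morphisms of `A` which are epimorphisms with kernel in `U`. -/
def epiKernelIn (U : A → Prop) : MorphismProperty A :=
  fun _ _ f => Epi f ∧ U (kernel f)

theorem epiKernelIn_comp {A : Type u} [Category.{v} A] [Abelian A] (U : A → Prop)
    (hext : ∀ S : ShortComplex A, S.ShortExact → U S.X₁ → U S.X₃ → U S.X₂)
    {x y z : A} (s : x ⟶ y) (t : y ⟶ z) (hs : epiKernelIn U s) (ht : epiKernelIn U t) :
    epiKernelIn U (s ≫ t) := by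
  obtain ⟨_, hs⟩ := hs
  obtain ⟨_, ht⟩ := ht
  refine ⟨epi_comp _ _, ?_⟩
  let i : kernel s ⟶ kernel (s ≫ t) := kernel.lift _ (kernel.ι s) (by simp)
  let p : kernel (s ≫ t) ⟶ kernel t := kernel.lift _ (kernel.ι (s ≫ t) ≫ s) (by simp)
  have hi : i ≫ kernel.ι (s ≫ t) = kernel.ι s := by simp [i]
  have hp : p ≫ kernel.ι t = kernel.ι (s ≫ t) ≫ s := by simp [p]
  have w0 : i ≫ p = 0 := by
    rw [← cancel_mono (kernel.ι t), Category.assoc, hp, reassoc_of% hi]; simp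
  have : Mono i := by
    have : Mono (i ≫ kernel.ι (s ≫ t)) := by rw [hi]; infer_instance
    exact mono_of_mono i (kernel.ι (s ≫ t))
  have : Epi p := by
    rw [epi_iff_surjective_up_to_refinements]
    intro T y₀
    obtain ⟨T', π, hπ, x₀, hx⟩ := surjective_up_to_refinements_of_epi s (y₀ ≫ kernel.ι t)
    refine ⟨T', π, hπ, kernel.lift _ x₀ ?_, ?_⟩
    · rw [← Category.assoc, ← hx]; simp
    · rw [← cancel_mono (kernel.ι t), Category.assoc, Category.assoc, hp]; simp [hx]
  have hex : (ShortComplex.mk i p w0).Exact := by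
    rw [ShortComplex.exact_iff_exact_up_to_refinements]
    intro T x₂ hx₂
    dsimp at x₂ hx₂
    have h0 : (x₂ ≫ kernel.ι (s ≫ t)) ≫ s = 0 := by
      rw [Category.assoc, ← hp, reassoc_of% hx₂, zero_comp]
    refine ⟨T, 𝟙 _, inferInstance, kernel.lift s _ h0, ?_⟩
    dsimp
    rw [← cancel_mono (kernel.ι (s ≫ t)), Category.assoc, Category.assoc, hi]
    simp
  exact hext _ (ShortComplex.ShortExact.mk' hex inferInstance inferInstance) hs ht

theorem epiKernelIn_leftCalc {A : Type u} [Category.{v} A] [Abelian A] (U : A → Prop)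
    (hzero : ∀ x : A, IsZero x → U x)
    (hext : ∀ S : ShortComplex A, S.ShortExact → U S.X₁ → U S.X₃ → U S.X₂)
    (hfilt : ∀ ⦃u x : A⦄, U u → ∀ α : u ⟶ x,
      ∃ (x' : A) (p : x ⟶ x'), Epi p ∧ U (kernel p) ∧ α ≫ p = 0) :
    (epiKernelIn U).HasLeftCalculusOfFractions where
  id_mem X := ⟨inferInstance, hzero _ (isZero_kernel_of_mono _)⟩
  comp_mem f g hf hg := epiKernelIn_comp U hext f g hf hg
  exists_leftFraction X Y φ := by
    obtain ⟨s, hs, f⟩ := φ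
    obtain ⟨he, hk⟩ := hs
    obtain ⟨Y', p, h1, h2, h3⟩ := hfilt hk (kernel.ι s ≫ f)
    refine ⟨⟨(Abelian.epiIsCokernelOfKernel _ (kernelIsKernel s)).desc
      (CokernelCofork.ofπ (f ≫ p) (by simpa using h3)), p, h1, h2⟩, ?_⟩
    exact ((Abelian.epiIsCokernelOfKernel _ (kernelIsKernel s)).fac
      (CokernelCofork.ofπ (f ≫ p) (by simpa using h3)) WalkingParallelPair.one).symm
  ext X' X Y f₁ f₂ s hs h := by
    have := hs.1
    exact ⟨Y, 𝟙 _, ⟨inferInstance, hzero _ (isZero_kernel_of_mono _)⟩,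
      by rw [(cancel_epi s).1 h]⟩

/-- Let `U` be a full subcategory of an abelian category `A`, closed under isomorphisms,
containing the zero objects, closed under extensions and left filtering, and let
`Q : A ⥤ D` be the localization of `A` at the class `W_U` of epimorphisms with kernel in `U`.
Then: (a) `Q 0` is a zero object; (b) `Q f` factors through `Q 0` iff `f` factors through an
object of `U`; (c) `Q x ≅ Q 0` iff `x` is a retract of an object of `U`. -/
theorem statement1 {D : Type u₂} [Category.{w} D] (U : A → Prop)
    (hiso : ∀ ⦃x y : A⦄, (x ≅ y) → U x → U y)
    (hzero : ∀ x : A, IsZero x → U x)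
    (hext : ∀ S : ShortComplex A, S.ShortExact → U S.X₁ → U S.X₃ → U S.X₂)
    (hfilt : ∀ ⦃u x : A⦄, U u → ∀ α : u ⟶ x,
      ∃ (x' : A) (p : x ⟶ x'), Epi p ∧ U (kernel p) ∧ α ≫ p = 0)
    (Q : A ⥤ D) [Q.IsLocalization (epiKernelIn U)] :
    IsZero (Q.obj (0 : A)) ∧
    (∀ ⦃x y : A⦄ (f : x ⟶ y),
      (∃ (a : Q.obj x ⟶ Q.obj (0 : A)) (b : Q.obj (0 : A) ⟶ Q.obj y), a ≫ b = Q.map f) ↔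
      (∃ (u : A) (g : x ⟶ u) (h : u ⟶ y), U u ∧ g ≫ h = f)) ∧
    (∀ x : A, Nonempty (Q.obj x ≅ Q.obj (0 : A)) ↔
      ∃ (u : A) (i : x ⟶ u) (r : u ⟶ x), U u ∧ i ≫ r = 𝟙 x) := by
  have := epiKernelIn_leftCalc U hzero hext hfilt
  have hinv : (epiKernelIn U).IsInvertedBy Q := Localization.inverts Q (epiKernelIn U)
  have hZ : IsZero (Q.obj (0 : A)) := by
    constructor
    · intro Y
      have := Localization.essSurj Q (epiKernelIn U)
      let e := Q.objObjPreimageIso Y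
      refine ⟨⟨⟨Q.map 0 ≫ e.hom⟩, fun g => ?_⟩⟩
      obtain ⟨φ, hφ⟩ := Localization.exists_leftFraction Q (epiKernelIn U) (g ≫ e.inv)
      have := hinv _ φ.hs
      have h : g ≫ e.inv = Q.map 0 := by
        rw [← cancel_mono (Q.map φ.s), hφ, MorphismProperty.LeftFraction.map_comp_map_s,
          ← Q.map_comp]
        congr 1
        exact (isZero_zero A).eq_of_src _ _
      rw [← h]; simp
    · intro Y
      have := Localization.essSurj Q (epiKernelIn U)
      let e := Q.objObjPreimageIso Y
      refine ⟨⟨⟨e.inv ≫ Q.map 0⟩, fun g => ?_⟩⟩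
      obtain ⟨φ, hφ⟩ := Localization.exists_leftFraction Q (epiKernelIn U) (e.hom ≫ g)
      have := hinv _ φ.hs
      have := φ.hs.1
      have hz : IsZero φ.Y' := IsZero.of_epi φ.s (isZero_zero A)
      have h : e.hom ≫ g = Q.map 0 := by
        rw [← cancel_mono (Q.map φ.s), hφ, MorphismProperty.LeftFraction.map_comp_map_s,
          ← Q.map_comp]
        congr 1
        exact hz.eq_of_tgt _ _
      rw [← h]; simp
  have hb : ∀ ⦃x y : A⦄ (f : x ⟶ y),
      (∃ (a : Q.obj x ⟶ Q.obj (0 : A)) (b : Q.obj (0 : A) ⟶ Q.obj y), a ≫ b = Q.map f) ↔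
      (∃ (u : A) (g : x ⟶ u) (h : u ⟶ y), U u ∧ g ≫ h = f) := by
    intro x y f
    constructor
    · rintro ⟨a, b, hab⟩
      have h0 : Q.map f = Q.map (0 : x ⟶ y) := by
        rw [← hab, ← comp_zero (f := (0 : x ⟶ (0 : A))), Q.map_comp]
        congr 1
        · exact hZ.eq_of_tgt _ _
        · exact hZ.eq_of_src _ _
      rw [MorphismProperty.map_eq_iff_postcomp Q (epiKernelIn U)] at h0
      obtain ⟨z, s, hs, h⟩ := h0
      exact ⟨kernel s, kernel.lift s f (by simpa using h), kernel.ι s, hs.2, by simp⟩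
    · rintro ⟨u, g, h, hu, rfl⟩
      have hw : epiKernelIn U (0 : u ⟶ (0 : A)) :=
        ⟨⟨fun _ _ _ => (isZero_zero A).eq_of_src _ _⟩, hiso kernelZeroIsoSource.symm hu⟩
      have := hinv _ hw
      exact ⟨Q.map g ≫ Q.map (0 : u ⟶ (0 : A)), inv (Q.map (0 : u ⟶ (0 : A))) ≫ Q.map h,
        by simp only [Category.assoc, IsIso.hom_inv_id_assoc, Q.map_comp]⟩
  refine ⟨hZ, hb, fun x => ?_⟩
  constructor
  · rintro ⟨e⟩
    exact (hb (𝟙 x)).1 ⟨e.hom, e.inv, by simp⟩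
  · intro h
    obtain ⟨a, b, hab⟩ := (hb (𝟙 x)).2 h
    exact ⟨⟨a, b, by simpa using hab, hZ.eq_of_src _ _⟩⟩
end

section
/- Let A be an abelian category, let U be a Serre subcategory of A, let W_U be the class of morphisms of A that are epimorphisms with kernel in U, and let Q : A → A[W_U⁻¹] be the localization functor. Then a morphism f : x → y of A becomes an isomorphism in A[W_U⁻¹] (i.e., Q f is an isomorphism) if and only if there exists a morphism g : y → y′ in A such that both g and g ∘ f are epimorphisms with kernel in U. -/
open CategoryTheory CategoryTheory.Limits Opposite

universe w v u u₂

variable {A : Type u} [Category.{v} A] [Abelian A]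

/-- `U` is a Serre subcategory of the abelian category `A`: a (full) subcategory, given by a
predicate on objects, closed under isomorphisms, containing the zero objects, and such that for
every short exact sequence `0 → a → b → c → 0` the middle object lies in `U` if and only if both
outer objects do. -/
def IsSerreSubcategory (U : A → Prop) : Prop :=
  (∀ ⦃x y : A⦄, (x ≅ y) → U x → U y) ∧
  (∀ x : A, IsZero x → U x) ∧
  (∀ S : ShortComplex A, S.ShortExact → (U S.X₂ ↔ U S.X₁ ∧ U S.X₃))

theorem aux_serre (U : A → Prop) (hU : IsSerreSubcategory U) :
    ObjectProperty.IsSerreClass (U : ObjectProperty A) where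
  exists_zero := ⟨_, isZero_zero A, hU.2.1 _ (isZero_zero A)⟩
  prop_of_mono {X Y} i _ hY :=
    ((hU.2.2 (ShortComplex.mk i (cokernel.π i) (cokernel.condition i))
      { exact := ShortComplex.exact_of_g_is_cokernel _ (cokernelIsCokernel i) }).1 hY).1
  prop_of_epi {X Y} p _ hX :=
    ((hU.2.2 (ShortComplex.mk (kernel.ι p) p (kernel.condition p))
      { exact := ShortComplex.exact_of_f_is_kernel _ (kernelIsKernel p) }).1 hX).2
  prop_X₂_of_shortExact hS h₁ h₃ := (hU.2.2 _ hS).2 ⟨h₁, h₃⟩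

theorem aux_frac (U : A → Prop) (hU : IsSerreSubcategory U) :
    (epiKernelIn U).HasLeftCalculusOfFractions := by
  have : ObjectProperty.IsSerreClass (U : ObjectProperty A) := aux_serre U hU
  let M := ObjectProperty.monoModSerre (U : ObjectProperty A)
  have hid : ∀ X : A, epiKernelIn U (𝟙 X) := fun X => ⟨inferInstance, M.id_mem X⟩
  exact
  { id_mem := hid
    comp_mem := fun f g hf hg => ⟨by
      have := hf.1
      have := hg.1
      infer_instance, M.comp_mem f g hf.2 hg.2⟩
    exists_leftFraction := fun X Y φ => by
      have h1 := φ.hs.1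
      have sq := IsPushout.of_hasPushout φ.s φ.f
      have h2 : M (pushout.inr φ.s φ.f) := MorphismProperty.of_isPushout sq.flip φ.hs.2
      exact ⟨⟨pushout.inl φ.s φ.f, pushout.inr φ.s φ.f, ⟨inferInstance, h2⟩⟩,
        pushout.condition.symm⟩
    ext := fun X' X Y f₁ f₂ s hs h => by
      have := hs.1
      exact ⟨Y, 𝟙 Y, hid Y, by rw [(cancel_epi s).1 h]⟩ }

theorem aux_exists {D : Type u₂} [Category.{w} D] (W : MorphismProperty A)
    [W.HasLeftCalculusOfFractions] (Q : A ⥤ D) [Q.IsLocalization W]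
    {x y : A} (f : x ⟶ y) (hf : IsIso (Q.map f)) :
    ∃ (y' : A) (g : y ⟶ y'), W (f ≫ g) := by
  obtain ⟨φ, hφ⟩ := Localization.exists_leftFraction Q W (inv (Q.map f))
  have h1 : Q.map φ.s = Q.map (f ≫ φ.f) := by
    have := φ.map_comp_map_s Q (Localization.inverts Q W)
    rw [← hφ] at this
    rw [Q.map_comp, ← this, IsIso.hom_inv_id_assoc]
  obtain ⟨Z, t, ht, e⟩ := (MorphismProperty.map_eq_iff_postcomp Q W _ _).1 h1
  refine ⟨Z, φ.f ≫ t, ?_⟩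
  rw [← Category.assoc, ← e]
  exact W.comp_mem _ _ φ.hs ht

theorem statement2 {D : Type u₂} [Category.{w} D] (U : A → Prop)
    (hU : IsSerreSubcategory U) (Q : A ⥤ D) [Q.IsLocalization (epiKernelIn U)]
    {x y : A} (f : x ⟶ y) :
    IsIso (Q.map f) ↔
      ∃ (y' : A) (g : y ⟶ y'),
        (Epi g ∧ U (kernel g)) ∧ (Epi (f ≫ g) ∧ U (kernel (f ≫ g))) := by
  have hS : ObjectProperty.IsSerreClass (U : ObjectProperty A) := aux_serre U hU
  have hF := aux_frac U hU
  constructor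
  · intro hf
    obtain ⟨y', g, hg⟩ := aux_exists (epiKernelIn U) Q f hf
    have h1 : IsIso (Q.map f ≫ Q.map g) := by
      rw [← Q.map_comp]
      exact Localization.inverts Q (epiKernelIn U) _ hg
    have h2 : IsIso (Q.map g) := IsIso.of_isIso_comp_left (Q.map f) (Q.map g)
    obtain ⟨z, h, hh⟩ := aux_exists (epiKernelIn U) Q g h2
    have := hg.1
    exact ⟨y', g, ⟨epi_of_epi f g, ObjectProperty.prop_of_mono (U : ObjectProperty A)
      (kernel.map g (g ≫ h) (𝟙 _) h (by simp)) hh.2⟩, hg⟩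
  · rintro ⟨y', g, hg, hfg⟩
    have h1 : IsIso (Q.map g) := Localization.inverts Q (epiKernelIn U) _ hg
    have h2 : IsIso (Q.map f ≫ Q.map g) := by
      rw [← Q.map_comp]
      exact Localization.inverts Q (epiKernelIn U) _ hfg
    exact IsIso.of_isIso_comp_right (Q.map f) (Q.map g)
end

section
/- Let A be an abelian category and let U be a Serre subcategory of A. Then the class W_U of epimorphisms with kernel in U contains all isomorphisms, is closed under composition, and has a left calculus of fractions: (i) for every s : x → x′ in W_U and every morphism f : x → y there exist t : y → y′ in W_U and g : x′ → y′ with g ∘ s = t ∘ f; (ii) whenever f₁, f₂ : x → y satisfy f₁ ∘ s = f₂ ∘ s for some s : x′ → x in W_U, then f₁ = f₂ (in particular there exists t in W_U with t ∘ f₁ = t ∘ f₂). -/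
open CategoryTheory CategoryTheory.Limits Opposite

universe v u

variable {A : Type u} [Category.{v} A] [Abelian A]

/-- For a Serre subcategory `U` of an abelian category `A`, the class `W_U` of epimorphisms with
kernel in `U` contains all isomorphisms, is closed under composition, and admits a left calculus
of fractions: (i) every span `x′ ←s x →f y` with `s ∈ W_U` can be completed to a commutative
square with `t : y → y′` in `W_U`; (ii) morphisms equalized by some `s ∈ W_U` are equal. -/
theorem statement3 (U : A → Prop) (hU : IsSerreSubcategory U) :
    (∀ ⦃x y : A⦄ (f : x ⟶ y), IsIso f → epiKernelIn U f) ∧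
    (∀ ⦃x y z : A⦄ (f : x ⟶ y) (g : y ⟶ z),
      epiKernelIn U f → epiKernelIn U g → epiKernelIn U (f ≫ g)) ∧
    (∀ ⦃x x' y : A⦄ (s : x ⟶ x') (_ : epiKernelIn U s) (f : x ⟶ y),
      ∃ (y' : A) (t : y ⟶ y') (g : x' ⟶ y'), epiKernelIn U t ∧ s ≫ g = f ≫ t) ∧
    (∀ ⦃x' x y : A⦄ (s : x' ⟶ x) (_ : epiKernelIn U s) (f₁ f₂ : x ⟶ y),
      s ≫ f₁ = s ≫ f₂ → f₁ = f₂) := by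
  obtain ⟨_, hz, hs⟩ := hU
  have hK : ∀ {x y : A} (f : x ⟶ y) [Mono f], U y → U x := fun f _ h =>
    ((hs (ShortComplex.mk f (cokernel.π f) (cokernel.condition f))
      { exact := ShortComplex.exact_cokernel f }).1 h).1
  have hQ : ∀ {x y : A} (f : x ⟶ y) [Epi f], U x → U y := fun f _ h =>
    ((hs (ShortComplex.mk (kernel.ι f) f (kernel.condition f))
      { exact := ShortComplex.exact_kernel f }).1 h).2
  let P : ObjectProperty A := U
  haveI : P.IsSerreClass :=
    { exists_zero := ⟨_, isZero_zero A, hz _ (isZero_zero A)⟩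
      prop_of_mono := fun f _ h => hK f h
      prop_of_epi := fun f _ h => hQ f h
      prop_X₂_of_shortExact := fun hS h₁ h₃ => (hs _ hS).2 ⟨h₁, h₃⟩ }
  refine ⟨?_, ?_, ?_, ?_⟩
  · intro x y f _
    exact ⟨inferInstance, P.monoModSerre_of_mono f⟩
  · rintro x y z f g ⟨_, hf⟩ ⟨_, hg⟩
    exact ⟨epi_comp f g, P.monoModSerre.comp_mem f g hf hg⟩
  · rintro x x' y s ⟨_, h⟩ f
    exact ⟨pushout s f, pushout.inr s f, pushout.inl s f,
      ⟨inferInstance, P.monoModSerre.of_isPushout (IsPushout.of_hasPushout s f).flip h⟩,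
      pushout.condition⟩
  · rintro x' x y s ⟨_, _⟩ f₁ f₂ h
    exact (cancel_epi s).1 h
end

section
/- Let A be an abelian category and let U be a Serre subcategory of A. Then U is strongly left filtering: in addition to being left filtering, for every monomorphism i : x → y and every epimorphism q : y → ȳ with kernel in U, there exist an epimorphism p : x → x′ with kernel in U, a monomorphism j : x′ → y′, and a morphism g : ȳ → y′ such that g ∘ q is an epimorphism with kernel in U and j ∘ p = g ∘ q ∘ i. -/
open CategoryTheory CategoryTheory.Limits Opposite

universe v u

variable {A : Type u} [Category.{v} A] [Abelian A]

/-- `U` is left filtering in `A`: for every `u ∈ U` and every morphism `α : u ⟶ x` there exists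
an epimorphism `p : x ⟶ x′` whose kernel lies in `U` and such that `p ∘ α = 0`. -/
def LeftFiltering (U : A → Prop) : Prop :=
  ∀ ⦃u x : A⦄, U u → ∀ α : u ⟶ x,
    ∃ (x' : A) (p : x ⟶ x'), Epi p ∧ U (kernel p) ∧ α ≫ p = 0

theorem serre_sub {U : A → Prop} (hU : IsSerreSubcategory U) {a b : A} (f : a ⟶ b) [Mono f]
    (hb : U b) : U a :=
  ((hU.2.2 (ShortComplex.mk f (cokernel.π f) (by simp))
    { exact := ShortComplex.exact_cokernel f }).1 hb).1

theorem serre_quot {U : A → Prop} (hU : IsSerreSubcategory U) {a b : A} (f : a ⟶ b) [Epi f]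
    (ha : U a) : U b :=
  ((hU.2.2 (ShortComplex.mk (kernel.ι f) f (by simp))
    { exact := ShortComplex.exact_kernel f }).1 ha).2

/-- A Serre subcategory `U` of an abelian category is strongly left filtering: it is left
filtering, and for every monomorphism `i : x ⟶ y` and every epimorphism `q : y ⟶ ȳ` with kernel
in `U`, there exist an epimorphism `p : x ⟶ x′` with kernel in `U`, a monomorphism
`j : x′ ⟶ y′` and a morphism `g : ȳ ⟶ y′` such that `g ∘ q` is an epimorphism with kernel in
`U` and `j ∘ p = g ∘ q ∘ i`. -/
theorem statement5 (U : A → Prop) (hU : IsSerreSubcategory U) :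
    LeftFiltering U ∧
    ∀ ⦃x y ybar : A⦄ (i : x ⟶ y) (q : y ⟶ ybar), Mono i → Epi q → U (kernel q) →
      ∃ (x' y' : A) (p : x ⟶ x') (j : x' ⟶ y') (g : ybar ⟶ y'),
        Epi p ∧ U (kernel p) ∧ Mono j ∧
        Epi (q ≫ g) ∧ U (kernel (q ≫ g)) ∧ p ≫ j = i ≫ q ≫ g := by
  refine ⟨fun u x hu α => ⟨cokernel α, cokernel.π α, inferInstance, ?_, by simp⟩, ?_⟩
  · exact serre_quot hU (Abelian.factorThruImage α) hu
  · intro x y ybar i q hi hq hk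
    refine ⟨_, ybar, Abelian.factorThruImage (i ≫ q), Abelian.image.ι (i ≫ q), 𝟙 _,
      inferInstance, ?_, inferInstance, ?_, ?_, by simp⟩
    · have w : (kernel.ι (Abelian.factorThruImage (i ≫ q)) ≫ i) ≫ q = 0 := by
        have e := kernel.condition (Abelian.factorThruImage (i ≫ q)) =≫ Abelian.image.ι (i ≫ q)
        rw [Category.assoc, Abelian.image.fac, zero_comp] at e
        rw [Category.assoc, e]
      have : Mono (kernel.lift q _ w) := by
        have : Mono (kernel.lift q _ w ≫ kernel.ι q) := by
          rw [kernel.lift_ι]; infer_instance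
        exact mono_of_mono _ (kernel.ι q)
      exact serre_sub hU (kernel.lift q _ w) hk
    · rw [Category.comp_id]; exact hq
    · rw [Category.comp_id]; exact hk
end

section
/- Let A be an abelian category, let ι : D → A be a fully faithful functor admitting a left adjoint L : A → D, and suppose that for every object x of A the unit morphism x → ι(L x) is an epimorphism. Let ker L denote the full subcategory of A spanned by the objects x such that ι(L x) is a zero object of A. Then ker L contains the zero objects, is closed under quotients (if x → y is an epimorphism and x lies in ker L, then y lies in ker L), is closed under extensions, and is left filtering in A: for every object u of ker L and every morphism α : u → x in A there exists an epimorphism p : x → x′ whose kernel lies in ker L and such that p ∘ α = 0. -/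
open CategoryTheory CategoryTheory.Limits Opposite

universe w v u u₂

variable {A : Type u} [Category.{v} A] [Abelian A]

/-- Let `A` be an abelian category, `ι : D ⥤ A` a fully faithful functor with left adjoint
`L : A ⥤ D` such that every unit morphism `x ⟶ ι (L x)` is an epimorphism.  Then the kernel of
`L` — the objects `x` with `ι (L x)` a zero object — contains the zero objects, is closed under
quotients and extensions, and is left filtering in `A`. -/
theorem statement8 {D : Type u₂} [Category.{w} D]
    (L : A ⥤ D) (ι : D ⥤ A) [ι.Full] [ι.Faithful] (adj : L ⊣ ι)
    (hunit : ∀ x : A, Epi (adj.unit.app x)) :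
    (∀ x : A, IsZero x → IsZero (ι.obj (L.obj x))) ∧
    (∀ ⦃x y : A⦄ (f : x ⟶ y), Epi f →
      IsZero (ι.obj (L.obj x)) → IsZero (ι.obj (L.obj y))) ∧
    (∀ S : ShortComplex A, S.ShortExact →
      IsZero (ι.obj (L.obj S.X₁)) → IsZero (ι.obj (L.obj S.X₃)) →
      IsZero (ι.obj (L.obj S.X₂))) ∧
    (∀ ⦃u x : A⦄, IsZero (ι.obj (L.obj u)) → ∀ α : u ⟶ x,
      ∃ (x' : A) (p : x ⟶ x'), Epi p ∧ IsZero (ι.obj (L.obj (kernel p))) ∧ α ≫ p = 0) := by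
  have key : ∀ x : A, adj.unit.app x = 0 → IsZero (ι.obj (L.obj x)) := by
    intro x h
    have := hunit x
    rw [IsZero.iff_id_eq_zero, ← cancel_epi (adj.unit.app x)]
    simp [h]
  have key2 : ∀ (x : A) (d : D) (f : x ⟶ ι.obj d), IsZero (ι.obj (L.obj x)) → f = 0 := by
    intro x d f h
    have e : adj.unit.app x ≫ ι.map ((adj.homEquiv x d).symm f) = f := by
      exact (adj.homEquiv_unit _ _ _).symm.trans ((adj.homEquiv x d).apply_symm_apply f)
    rw [← e, h.eq_of_tgt (adj.unit.app x) 0, zero_comp]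
  have quot : ∀ ⦃x y : A⦄ (f : x ⟶ y), Epi f →
      IsZero (ι.obj (L.obj x)) → IsZero (ι.obj (L.obj y)) := by
    intro x y f hf h
    apply key
    rw [← cancel_epi f, comp_zero]
    exact key2 _ _ _ h
  refine ⟨fun x hx => key _ (hx.eq_of_src _ _), quot, ?_, ?_⟩
  · intro S hS h1 h3
    apply key
    have := hS.epi_g
    have e : S.f ≫ adj.unit.app S.X₂ = 0 := key2 _ _ _ h1
    rw [← hS.exact.g_desc _ e, key2 _ _ (hS.exact.desc _ e) h3, comp_zero]
  · intro u x hu α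
    refine ⟨cokernel α, cokernel.π α, inferInstance, ?_, cokernel.condition α⟩
    exact quot (Abelian.factorThruImage α) inferInstance hu
end

section
/- Let C be an additive category, let Karoubi(C) be its Karoubi envelope (idempotent completion) with canonical functor t : C → Karoubi(C), and let C₀ be the full subcategory of Karoubi(C) spanned by the objects X such that there exist objects c, c′ of C with X ⊕ t(c) isomorphic to t(c′). Then: (i) C₀ contains the image of t; (ii) C₀ is closed under finite biproducts in Karoubi(C); (iii) C₀ is weakly idempotent complete: whenever i : X → Y and r : Y → X are morphisms between objects of C₀ with r ∘ i = id_X, there exists an object Z of C₀ such that Y is isomorphic to X ⊕ Z. -/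
open CategoryTheory CategoryTheory.Limits CategoryTheory.Idempotents

universe v u

attribute [local instance] CategoryTheory.Limits.hasBinaryBiproducts_of_finite_biproducts

/-- The full subcategory of the Karoubi envelope of an additive category `C` spanned by the
objects `X` such that `X ⊕ t c ≅ t c′` for some objects `c`, `c′` of `C`, where
`t : C ⥤ Karoubi C` is the canonical functor. -/
def weakCompletion (C : Type u) [Category.{v} C] [Preadditive C] [HasFiniteBiproducts C]
    (X : Karoubi C) : Prop :=
  ∃ (c c' : C), Nonempty ((X ⊞ (toKaroubi C).obj c) ≅ (toKaroubi C).obj c')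

section helpers

variable {C : Type u} [Category.{v} C] [Preadditive C] [HasFiniteBiproducts C]

theorem tbiprod (c d : C) :
    Nonempty ((toKaroubi C).obj c ⊞ (toKaroubi C).obj d ≅ (toKaroubi C).obj (c ⊞ d)) := by
  refine ⟨?_⟩
  exact
    { hom := biprod.desc ((toKaroubi C).map biprod.inl) ((toKaroubi C).map biprod.inr)
      inv := biprod.lift ((toKaroubi C).map biprod.fst) ((toKaroubi C).map biprod.snd)
      hom_inv_id := by
        apply biprod.hom_ext' <;> apply biprod.hom_ext <;>
          simp [← Functor.map_comp, -toKaroubi_map_f, -Karoubi.hom_ext_iff]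
      inv_hom_id := by
        rw [biprod.lift_desc, ← Functor.map_comp, ← Functor.map_comp, ← Functor.map_add,
          biprod.total, CategoryTheory.Functor.map_id] }

theorem exists_compl {X Y : Karoubi C} (i : X ⟶ Y) (r : Y ⟶ X) (h : i ≫ r = 𝟙 X) :
    ∃ Z : Karoubi C, Nonempty (Y ≅ X ⊞ Z) := by
  have hp : (r ≫ i) ≫ (r ≫ i) = r ≫ i := by
    rw [Category.assoc, reassoc_of% h]
  obtain ⟨Z, j, e, h1, h2⟩ :=
    IsIdempotentComplete.idempotents_split Y (𝟙 Y - r ≫ i) (idem_of_id_sub_idem _ hp)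
  have hie : i ≫ e = 0 := by
    have : i ≫ (e ≫ j) ≫ e = 0 := by
      rw [h2, Preadditive.sub_comp, Preadditive.comp_sub, Category.id_comp, Category.assoc,
        reassoc_of% h, sub_self]
    simpa only [Category.assoc, h1, Category.comp_id] using this
  have hjr : j ≫ r = 0 := by
    have : j ≫ (e ≫ j) ≫ r = 0 := by
      rw [h2, Preadditive.sub_comp, Preadditive.comp_sub, Category.id_comp, Category.assoc,
        h, Category.comp_id, sub_self]
    simpa only [Category.assoc, reassoc_of% h1] using this
  refine ⟨Z, ⟨⟨biprod.lift r e, biprod.desc i j, ?_, ?_⟩⟩⟩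
  · rw [biprod.lift_desc, h2]
    abel
  · apply biprod.hom_ext' <;> apply biprod.hom_ext <;>
      simp [h, h1, hie, hjr, -Karoubi.hom_ext_iff]

end helpers

/-- Let `C` be an additive category, `Karoubi C` its idempotent completion with canonical functor
`t : C ⥤ Karoubi C`, and let `C₀` be the full subcategory of `Karoubi C` of objects `X` such that
`X ⊕ t c ≅ t c′` for some `c`, `c′` in `C`.  Then: (i) `C₀` contains the image of `t`;
(ii) `C₀` is closed under finite biproducts (it contains the zero objects and is closed under
binary biproducts); (iii) `C₀` is weakly idempotent complete: every object of `C₀` which is a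
retract of an object `Y` of `C₀` admits a complement in `C₀`. -/
theorem statement10 (C : Type u) [Category.{v} C] [Preadditive C] [HasFiniteBiproducts C] :
    (∀ c : C, weakCompletion C ((toKaroubi C).obj c)) ∧
    ((∀ Z : Karoubi C, IsZero Z → weakCompletion C Z) ∧
      ∀ X Y : Karoubi C, weakCompletion C X → weakCompletion C Y →
        weakCompletion C (X ⊞ Y)) ∧
    (∀ X Y : Karoubi C, weakCompletion C X → weakCompletion C Y →
      ∀ (i : X ⟶ Y) (r : Y ⟶ X), i ≫ r = 𝟙 X →
        ∃ Z : Karoubi C, weakCompletion C Z ∧ Nonempty (Y ≅ X ⊞ Z)) := by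
  refine ⟨fun c => ⟨c, _, tbiprod c c⟩, ⟨fun Z hZ => ⟨Z.X, Z.X, ⟨?_⟩⟩, ?_⟩, ?_⟩
  · exact (isoZeroBiprod hZ).symm
  · rintro X Y ⟨a, a', ⟨f⟩⟩ ⟨b, b', ⟨g⟩⟩
    obtain ⟨k⟩ := tbiprod a b
    obtain ⟨k'⟩ := tbiprod a' b'
    refine ⟨a ⊞ b, a' ⊞ b', ⟨?_⟩⟩
    exact biprod.mapIso (Iso.refl _) k.symm ≪≫ biprod.associator _ _ _ ≪≫
      biprod.mapIso (Iso.refl _) ((biprod.associator _ _ _).symm ≪≫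
        biprod.mapIso (biprod.braiding _ _) (Iso.refl _) ≪≫ biprod.associator _ _ _) ≪≫
      (biprod.associator _ _ _).symm ≪≫ biprod.mapIso f g ≪≫ k'
  · rintro X Y ⟨a, a', ⟨f⟩⟩ ⟨b, b', ⟨g⟩⟩ i r h
    obtain ⟨Z, ⟨φ⟩⟩ := exists_compl i r h
    refine ⟨Z, ?_, ⟨φ⟩⟩
    obtain ⟨k⟩ := tbiprod a' b
    obtain ⟨k'⟩ := tbiprod b' a
    refine ⟨a' ⊞ b, b' ⊞ a, ⟨?_⟩⟩
    let ψ : Z ⊞ (toKaroubi C).obj a' ≅ Y ⊞ (toKaroubi C).obj a :=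
      biprod.mapIso (Iso.refl _) f.symm ≪≫ (biprod.associator _ _ _).symm ≪≫
        biprod.mapIso (biprod.braiding _ _ ≪≫ φ.symm) (Iso.refl _)
    exact biprod.mapIso (Iso.refl _) k.symm ≪≫ (biprod.associator _ _ _).symm ≪≫
      biprod.mapIso ψ (Iso.refl _) ≪≫ biprod.associator _ _ _ ≪≫
      biprod.mapIso (Iso.refl _) (biprod.braiding _ _) ≪≫ (biprod.associator _ _ _).symm ≪≫
      biprod.mapIso g (Iso.refl _) ≪≫ k'
end
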